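/- arXiv:1610.09413 — 3 statements merged into one kernel-verified Lean document; each statement's English description precedes it below -/
import Mathlib

section
/- Sufficient condition for exact relaxation of the storage complementarity constraint: Let p_dis, p_ch, ψ_dis, ψ_ch, φ_dis, φ_ch, γ, λ, c_dis, c_ch, η_dis, η_ch be real numbers with p_dis ≥ 0, p_ch ≥ 0, ψ_dis ≥ 0, ψ_ch ≥ 0, φ_dis ≤ 0, φ_ch ≤ 0, η_dis > 0, and suppose the KKT stationarity equations c_dis − φ_dis − ψ_dis + γ + λ/η_dis = 0 and c_ch − φ_ch − ψ_ch − γ − λ·η_ch = 0 hold, together with the complementary slackness conditions ψ_dis·p_dis = 0 and ψ_ch·p_ch = 0. If c_dis + c_ch > −(1/η_dis − η_ch)·λ, then p_dis·p_ch = 0 (the storage unit does not charge and discharge simultaneously). -/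
/-- Sufficient condition for exact relaxation of the storage complementarity
constraint: under KKT stationarity and complementary slackness, if
`c_dis + c_ch > -(1/η_dis - η_ch) * lmp` then the storage unit does not charge
and discharge simultaneously. -/
theorem storage_no_simultaneous_charge_discharge
    (p_dis p_ch ψ_dis ψ_ch φ_dis φ_ch γ lmp c_dis c_ch η_dis η_ch : ℝ)
    (hpdis : 0 ≤ p_dis) (hpch : 0 ≤ p_ch)
    (hψdis : 0 ≤ ψ_dis) (hψch : 0 ≤ ψ_ch)
    (hφdis : φ_dis ≤ 0) (hφch : φ_ch ≤ 0)
    (hηdis : 0 < η_dis)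
    (hstat_dis : c_dis - φ_dis - ψ_dis + γ + lmp / η_dis = 0)
    (hstat_ch : c_ch - φ_ch - ψ_ch - γ - lmp * η_ch = 0)
    (hcs_dis : ψ_dis * p_dis = 0) (hcs_ch : ψ_ch * p_ch = 0)
    (hsuff : c_dis + c_ch > -(1 / η_dis - η_ch) * lmp) :
    p_dis * p_ch = 0 := by
  by_contra h
  obtain ⟨hdis, hch⟩ := mul_ne_zero_iff.mp h
  have hψdis_zero : ψ_dis = 0 := (mul_eq_zero.mp hcs_dis).resolve_right hdis
  have hψch_zero : ψ_ch = 0 := (mul_eq_zero.mp hcs_ch).resolve_right hch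
  have hprice : -(1 / η_dis - η_ch) * lmp = lmp * η_ch - lmp / η_dis := by ring
  linarith
end

section
/- Necessary condition for simultaneous charging and discharging: Let p_dis, p_ch, ψ_dis, ψ_ch, φ_dis, φ_ch, γ, λ, c_dis, c_ch, η_dis, η_ch be real numbers with ψ_dis ≥ 0, ψ_ch ≥ 0, φ_dis ≤ 0, φ_ch ≤ 0, η_dis > 0, satisfying the KKT stationarity equations c_dis − φ_dis − ψ_dis + γ + λ/η_dis = 0 and c_ch − φ_ch − ψ_ch − γ − λ·η_ch = 0 and the complementary slackness conditions ψ_dis·p_dis = 0 and ψ_ch·p_ch = 0. If p_dis > 0 and p_ch > 0, then c_dis + c_ch ≤ −(1/η_dis − η_ch)·λ. -/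
/-- Necessary condition for simultaneous charging and discharging: under KKT
stationarity and complementary slackness, if `p_dis > 0` and `p_ch > 0` then
`c_dis + c_ch ≤ -(1/η_dis - η_ch) * lmp`. -/
theorem simultaneous_charge_discharge_necessary_condition
    (p_dis p_ch ψ_dis ψ_ch φ_dis φ_ch γ lmp c_dis c_ch η_dis η_ch : ℝ)
    (hψdis : 0 ≤ ψ_dis) (hψch : 0 ≤ ψ_ch)
    (hφdis : φ_dis ≤ 0) (hφch : φ_ch ≤ 0)
    (hηdis : 0 < η_dis)
    (hstat_dis : c_dis - φ_dis - ψ_dis + γ + lmp / η_dis = 0)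
    (hstat_ch : c_ch - φ_ch - ψ_ch - γ - lmp * η_ch = 0)
    (hcs_dis : ψ_dis * p_dis = 0) (hcs_ch : ψ_ch * p_ch = 0)
    (hpdis : 0 < p_dis) (hpch : 0 < p_ch) :
    c_dis + c_ch ≤ -(1 / η_dis - η_ch) * lmp := by
  have hψ_dis_zero : ψ_dis = 0 := (mul_eq_zero.mp hcs_dis).resolve_right hpdis.ne'
  have hψ_ch_zero : ψ_ch = 0 := (mul_eq_zero.mp hcs_ch).resolve_right hpch.ne'
  have hrhs : -(1 / η_dis - η_ch) * lmp = lmp * η_ch - lmp / η_dis := by ring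
  linarith
end

section
/- Linear representation of the daily storage operating revenue: Fix n ≥ 1 and real constants p_R, e_R, c_ch, c_dis, c_eu, c_ed, T, η_ch ≠ 0, η_dis. Let e, p_ch, p_dis, r_eu, r_ed, ψ_ch, ψ_dis, ψ_ru, ψ_rd, ψ_soc, φ_ch, φ_dis, φ_soc, γ, λ, λ_ru, λ_rd be real sequences on t = 1,…,n (with e(0) = 0), and assume: (i) the state-of-charge recursion e(t) − e(t−1) = p_ch(t) − p_dis(t) for all t; (ii) the dual stationarity equations φ_soc(t) + ψ_soc(t) + γ(t) − γ(t+1) = 0 for 1 ≤ t ≤ n−1, and φ_soc(n) + ψ_soc(n) + γ(n) = 0; φ_ch(t) + ψ_ch(t) − γ(t) − λ(t)/η_ch = c_ch; φ_dis(t) + ψ_dis(t) + γ(t) + λ(t)·η_dis = c_dis; φ_ch(t) + ψ_rd(t) + T·φ_soc(t) + λ_rd(t)/η_ch = c_ed; φ_dis(t) + ψ_ru(t) − T·ψ_soc(t) + λ_ru(t)·η_dis = c_eu for all t; (iii) the complementary slackness conditions ψ_ch(t)·p_ch(t) = 0, ψ_dis(t)·p_dis(t) = 0, ψ_ru(t)·r_eu(t)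 = 0, ψ_rd(t)·r_ed(t) = 0, φ_ch(t)·(p_ch(t) + r_ed(t) − p_R) = 0, φ_dis(t)·(p_dis(t) + r_eu(t) − p_R) = 0, φ_soc(t)·(e(t) + T·r_ed(t) − e_R) = 0, and ψ_soc(t)·(e(t) − T·r_eu(t)) = 0 for all t. Then the daily operating revenue satisfies Σ_{t=1}^{n} [ p_dis(t)·(λ(t)·η_dis − c_dis) − p_ch(t)·(λ(t)/η_ch + c_ch) + r_eu(t)·(λ_ru(t)·η_dis − c_eu) + r_ed(t)·(λ_rd(t)/η_ch − c_ed) ] = −Σ_{t=1}^{n} [ (φ_ch(t) + φ_dis(t))·p_R + φ_soc(t)·e_R ]. -/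
/-- The sum of `f (t + 1) * g t - f t * g (t - 1)` over `1 ≤ t ≤ n` telescopes. -/
theorem sum_Icc_one_shift_mul_sub (f g : ℕ → ℝ) (n : ℕ) :
    ∑ t ∈ Finset.Icc 1 n, (f (t + 1) * g t - f t * g (t - 1)) =
      f (n + 1) * g n - f 1 * g 0 := by
  induction n with
  | zero => simp
  | succ k ih =>
    rw [Finset.sum_Icc_succ_top (by omega), ih, Nat.add_sub_cancel]
    ring

/-- Linear representation of the daily storage operating revenue in terms of
the dual multipliers of the power- and energy-rating constraints. -/
theorem storage_daily_revenue_linear_representation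
    (n : ℕ) (hn : 1 ≤ n)
    (p_R e_R c_ch c_dis c_eu c_ed T η_ch η_dis : ℝ) (hηch : η_ch ≠ 0)
    (e p_ch p_dis r_eu r_ed ψ_ch ψ_dis ψ_ru ψ_rd ψ_soc φ_ch φ_dis φ_soc γ
      lmp lam_ru lam_rd : ℕ → ℝ)
    (he0 : e 0 = 0)
    -- (i) state-of-charge recursion
    (hrec : ∀ t, 1 ≤ t → t ≤ n → e t - e (t - 1) = p_ch t - p_dis t)
    -- (ii) dual stationarity equations
    (hsoc : ∀ t, 1 ≤ t → t ≤ n - 1 → φ_soc t + ψ_soc t + γ t - γ (t + 1) = 0)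
    (hsocn : φ_soc n + ψ_soc n + γ n = 0)
    (hch : ∀ t, 1 ≤ t → t ≤ n → φ_ch t + ψ_ch t - γ t - lmp t / η_ch = c_ch)
    (hdis : ∀ t, 1 ≤ t → t ≤ n → φ_dis t + ψ_dis t + γ t + lmp t * η_dis = c_dis)
    (hed : ∀ t, 1 ≤ t → t ≤ n → φ_ch t + ψ_rd t + T * φ_soc t + lam_rd t / η_ch = c_ed)
    (heu : ∀ t, 1 ≤ t → t ≤ n → φ_dis t + ψ_ru t - T * ψ_soc t + lam_ru t * η_dis = c_eu)
    -- (iii) complementary slackness conditions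
    (hcs_ch : ∀ t, 1 ≤ t → t ≤ n → ψ_ch t * p_ch t = 0)
    (hcs_dis : ∀ t, 1 ≤ t → t ≤ n → ψ_dis t * p_dis t = 0)
    (hcs_ru : ∀ t, 1 ≤ t → t ≤ n → ψ_ru t * r_eu t = 0)
    (hcs_rd : ∀ t, 1 ≤ t → t ≤ n → ψ_rd t * r_ed t = 0)
    (hcs_φch : ∀ t, 1 ≤ t → t ≤ n → φ_ch t * (p_ch t + r_ed t - p_R) = 0)
    (hcs_φdis : ∀ t, 1 ≤ t → t ≤ n → φ_dis t * (p_dis t + r_eu t - p_R) = 0)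
    (hcs_φsoc : ∀ t, 1 ≤ t → t ≤ n → φ_soc t * (e t + T * r_ed t - e_R) = 0)
    (hcs_ψsoc : ∀ t, 1 ≤ t → t ≤ n → ψ_soc t * (e t - T * r_eu t) = 0) :
    ∑ t ∈ Finset.Icc 1 n,
        (p_dis t * (lmp t * η_dis - c_dis) - p_ch t * (lmp t / η_ch + c_ch)
          + r_eu t * (lam_ru t * η_dis - c_eu) + r_ed t * (lam_rd t / η_ch - c_ed)) =
      -∑ t ∈ Finset.Icc 1 n, ((φ_ch t + φ_dis t) * p_R + φ_soc t * e_R) := by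
  set G : ℕ → ℝ := fun t => if t ≤ n then γ t else 0 with hG
  have hGn : G (n + 1) = 0 := by simp [hG]
  have hGle : ∀ t, t ≤ n → G t = γ t := fun t ht => by simp [hG, ht]
  have hstat : ∀ t, 1 ≤ t → t ≤ n → φ_soc t + ψ_soc t + γ t - G (t + 1) = 0 := by
    intro t h1 h2
    rcases h2.eq_or_lt with rfl | hlt
    · rw [hGn, sub_zero, hsocn]
    · rw [hGle _ hlt]
      exact hsoc t h1 (by omega)
  have htel : ∑ t ∈ Finset.Icc 1 n, (G (t + 1) * e t - G t * e (t - 1)) = 0 := by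
    rw [sum_Icc_one_shift_mul_sub, hGn, he0]
    ring
  rw [eq_neg_iff_add_eq_zero, ← Finset.sum_add_distrib, ← htel]
  refine Finset.sum_congr rfl fun t ht => ?_
  obtain ⟨h1, h2⟩ := Finset.mem_Icc.mp ht
  rw [hGle t h2]
  linear_combination p_dis t * hdis t h1 h2 + p_ch t * hch t h1 h2
    + r_eu t * heu t h1 h2 + r_ed t * hed t h1 h2
    - γ t * hrec t h1 h2 + e t * hstat t h1 h2
    - hcs_ch t h1 h2 - hcs_dis t h1 h2 - hcs_ru t h1 h2 - hcs_rd t h1 h2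
    - hcs_φch t h1 h2 - hcs_φdis t h1 h2 - hcs_φsoc t h1 h2 - hcs_ψsoc t h1 h2
end
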